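/- Under the SVARM model, conditionally on the sample counts m_i⁺ and m_i⁻, the variance of the estimate φ̂_i is exactly Var[φ̂_i | m_i⁺, m_i⁻] = σ_i⁺²/m_i⁺ + σ_i⁻²/m_i⁻, where σ_i⁺² = Var[ν(A ∪ {i})] and σ_i⁻² = Var[ν(A)] for A ∼ P^w on subsets of N_i. -/

import Mathlib

open Finset
open scoped Classical

noncomputable section

/-- The `n`-th harmonic number `Hₙ = ∑_{k=1}^n 1/k`. -/
def harm (n : ℕ) : ℝ := ∑ k ∈ Finset.range n, (1 : ℝ) / (k + 1)

/-- The player set `N_i = N \ {i}`. -/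
def Ni (n : ℕ) (i : Fin n) : Finset (Fin n) := Finset.univ.erase i

/-- The Shapley weights `w_S = 1/(n·C(n−1,|S|))` (defining `P^w` on subsets of `N_i`). -/
def wgt (n : ℕ) (S : Finset (Fin n)) : ℝ :=
  1 / ((n : ℝ) * (Nat.choose (n - 1) S.card : ℝ))

/-- The SVARM sampling distribution `P⁺(S) = 1/(|S|·C(n,|S|)·Hₙ)` on nonempty `S ⊆ N`
(the formula evaluates to `0` on `S = ∅` by division-by-zero conventions). -/
def Pplus (n : ℕ) (S : Finset (Fin n)) : ℝ :=
  1 / ((S.card : ℝ) * (Nat.choose n S.card : ℝ) * harm n)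

/-- The SVARM sampling distribution `P⁻(S) = 1/((n−|S|)·C(n,|S|)·Hₙ)` on proper `S ⊊ N`
(the formula evaluates to `0` on `S = N` by division-by-zero conventions). -/
def Pminus (n : ℕ) (S : Finset (Fin n)) : ℝ :=
  1 / (((n : ℝ) - (S.card : ℝ)) * (Nat.choose n S.card : ℝ) * harm n)

/-- Sample space of SVARM with `K` main-loop pairs: warm-up samples `B⁺, B⁻` and main
samples `A₁⁺,…,A_K⁺`, `A₁⁻,…,A_K⁻`. -/
abbrev Omega (n K : ℕ) :=
  Finset (Fin n) × Finset (Fin n) × (Fin K → Finset (Fin n)) × (Fin K → Finset (Fin n))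

/-- Joint pmf of the mutually independent samples `B⁺, B⁻ ∼ P^w` (subsets of `N_i`),
`A₁⁺,…,A_K⁺` i.i.d. `∼ P⁺` and `A₁⁻,…,A_K⁻` i.i.d. `∼ P⁻`. -/
def jointP (n K : ℕ) (i : Fin n) (ω : Omega n K) : ℝ :=
  (if ω.1 ⊆ Ni n i then wgt n ω.1 else 0) *
    (if ω.2.1 ⊆ Ni n i then wgt n ω.2.1 else 0) *
    (∏ k, Pplus n (ω.2.2.1 k)) * (∏ k, Pminus n (ω.2.2.2 k))

/-- Expectation with respect to the joint distribution of the SVARM samples. -/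
def expVal (n K : ℕ) (i : Fin n) (f : Omega n K → ℝ) : ℝ :=
  ∑ ω : Omega n K, jointP n K i ω * f ω

/-- Probability of an event under the joint distribution of the SVARM samples. -/
def probEvent (n K : ℕ) (i : Fin n) (E : Omega n K → Prop) : ℝ :=
  ∑ ω : Omega n K, if E ω then jointP n K i ω else 0

/-- The sample count `m_i⁺ = 1 + #{k : i ∈ A_k⁺}`. -/
def mplus (n K : ℕ) (i : Fin n) (ω : Omega n K) : ℕ :=
  1 + (Finset.univ.filter fun k => i ∈ ω.2.2.1 k).card

/-- The sample count `m_i⁻ = 1 + #{k : i ∉ A_k⁻}`. -/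
def mminus (n K : ℕ) (i : Fin n) (ω : Omega n K) : ℕ :=
  1 + (Finset.univ.filter fun k => i ∉ ω.2.2.2 k).card

/-- The estimate `φ̂_i⁺ = (ν(B⁺ ∪ {i}) + ∑_{k : i ∈ A_k⁺} ν(A_k⁺))/m_i⁺`. -/
def phiHatPlus (n K : ℕ) (ν : Finset (Fin n) → ℝ) (i : Fin n) (ω : Omega n K) : ℝ :=
  (ν (insert i ω.1) + ∑ k ∈ Finset.univ.filter (fun k => i ∈ ω.2.2.1 k), ν (ω.2.2.1 k)) /
    (mplus n K i ω : ℝ)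

/-- The estimate `φ̂_i⁻ = (ν(B⁻) + ∑_{k : i ∉ A_k⁻} ν(A_k⁻))/m_i⁻`. -/
def phiHatMinus (n K : ℕ) (ν : Finset (Fin n) → ℝ) (i : Fin n) (ω : Omega n K) : ℝ :=
  (ν ω.2.1 + ∑ k ∈ Finset.univ.filter (fun k => i ∉ ω.2.2.2 k), ν (ω.2.2.2 k)) /
    (mminus n K i ω : ℝ)

/-- The SVARM estimator `φ̂_i = φ̂_i⁺ − φ̂_i⁻`. -/
def phiHat (n K : ℕ) (ν : Finset (Fin n) → ℝ) (i : Fin n) (ω : Omega n K) : ℝ :=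
  phiHatPlus n K ν i ω - phiHatMinus n K ν i ω

/-- The Shapley value `φ_i = ∑_{S ⊆ N_i} w_S (ν(S∪{i}) − ν(S))`. -/
def shapley (n : ℕ) (ν : Finset (Fin n) → ℝ) (i : Fin n) : ℝ :=
  ∑ S ∈ (Ni n i).powerset, wgt n S * (ν (insert i S) - ν S)

/-- The positive Shapley value `φ_i⁺ = E[ν(A ∪ {i})]` for `A ∼ P^w`. -/
def phiPlus (n : ℕ) (ν : Finset (Fin n) → ℝ) (i : Fin n) : ℝ :=
  ∑ S ∈ (Ni n i).powerset, wgt n S * ν (insert i S)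

/-- The negative Shapley value `φ_i⁻ = E[ν(A)]` for `A ∼ P^w`. -/
def phiMinus (n : ℕ) (ν : Finset (Fin n) → ℝ) (i : Fin n) : ℝ :=
  ∑ S ∈ (Ni n i).powerset, wgt n S * ν S

/-- The variance `σ_i⁺² = Var[ν(A ∪ {i})]` for `A ∼ P^w`. -/
def sigPlusSq (n : ℕ) (ν : Finset (Fin n) → ℝ) (i : Fin n) : ℝ :=
  ∑ S ∈ (Ni n i).powerset, wgt n S * (ν (insert i S) - phiPlus n ν i) ^ 2

/-- The variance `σ_i⁻² = Var[ν(A)]` for `A ∼ P^w`. -/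
def sigMinusSq (n : ℕ) (ν : Finset (Fin n) → ℝ) (i : Fin n) : ℝ :=
  ∑ S ∈ (Ni n i).powerset, wgt n S * (ν S - phiMinus n ν i) ^ 2

end

open scoped Classical in
/-- Conditional expectation of `f` given the event `E` under the SVARM joint distribution. -/
noncomputable def condExpVal (n K : ℕ) (i : Fin n) (E : Omega n K → Prop)
    (f : Omega n K → ℝ) : ℝ :=
  (∑ ω : Omega n K, if E ω then jointP n K i ω * f ω else 0) / probEvent n K i E

/-- Conditional variance of `f` given the event `E` under the SVARM joint distribution. -/
noncomputable def condVar (n K : ℕ) (i : Fin n) (E : Omega n K → Prop)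
    (f : Omega n K → ℝ) : ℝ :=
  condExpVal n K i E (fun ω => (f ω - condExpVal n K i E f) ^ 2)

section WeightedSums

variable {X : Type*} [Fintype X]

lemma sum_pi_succ_eq {K : ℕ} (F : (Fin (K + 1) → X) → ℝ) :
    ∑ A, F A = ∑ x, ∑ A : Fin K → X, F (Fin.cons x A) := by
  rw [← Fintype.sum_prod_type' (fun x (A : Fin K → X) => F (Fin.cons x A))]
  exact (Fintype.sum_equiv (Fin.consEquiv fun _ => X) _ _ fun _ => rfl).symm

/-- First and second moments of a sum of centred terms, weighted by a function of the number
of terms that are present. -/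
lemma weighted_moments_sum (q h : X → ℝ) (c : X → Prop) [DecidablePred c] (s : ℝ)
    (h₁ : ∑ x with c x, q x * h x = 0)
    (h₂ : ∑ x with c x, q x * h x ^ 2 = s * ∑ x with c x, q x) (K : ℕ) :
    ∀ w : ℕ → ℝ,
      (∑ A : Fin K → X, (∏ k, q (A k)) * (w (#{k | c (A k)}) * ∑ k with c (A k), h (A k)) = 0) ∧
      (∑ A : Fin K → X, (∏ k, q (A k)) *
          (w (#{k | c (A k)}) * (∑ k with c (A k), h (A k)) ^ 2) =
        s * ∑ A : Fin K → X, (∏ k, q (A k)) * (w (#{k | c (A k)}) * #{k | c (A k)})) := by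
  induction K with
  | zero => intro w; simp
  | succ K ih =>
    intro w
    have hcard (x : X) (A : Fin K → X) :
        #{k | c ((Fin.cons x A : Fin (K + 1) → X) k)} =
          (if c x then 1 else 0) + #{k | c (A k)} := by
      simp only [Finset.card_filter, Fin.sum_univ_succ, Fin.cons_zero, Fin.cons_succ]
    have hsum (x : X) (A : Fin K → X) :
        ∑ k with c ((Fin.cons x A : Fin (K + 1) → X) k), h ((Fin.cons x A : Fin (K + 1) → X) k) =
          (if c x then h x else 0) + ∑ k with c (A k), h (A k) := by
      simp [Finset.sum_filter, Fin.sum_univ_succ]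
    have hprod (x : X) (A : Fin K → X) :
        ∏ k, q ((Fin.cons x A : Fin (K + 1) → X) k) = q x * ∏ k, q (A k) := by
      simp [Fin.prod_univ_succ]
    simp only [sum_pi_succ_eq, hcard, hsum, hprod]
    obtain ⟨i₁, i₂⟩ := ih w
    obtain ⟨j₁, j₂⟩ := ih fun m => w (1 + m)
    set M := ∑ A : Fin K → X, (∏ k, q (A k)) * w (1 + #{k | c (A k)}) with hM
    set N := ∑ A : Fin K → X, (∏ k, q (A k)) * (w (1 + #{k | c (A k)}) * #{k | c (A k)}) with hN
    set R := ∑ A : Fin K → X, (∏ k, q (A k)) * (w (#{k | c (A k)}) * #{k | c (A k)}) with hR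
    constructor
    · have key (x : X) : ∑ A : Fin K → X, q x * (∏ k, q (A k)) *
          (w ((if c x then 1 else 0) + #{k | c (A k)}) *
            ((if c x then h x else 0) + ∑ k with c (A k), h (A k))) =
          (if c x then q x * h x else 0) * M := by
        split_ifs with hx
        · have : q x * h x * M = q x * h x * M + q x * 0 := by ring
          rw [this, ← j₁, hM, Finset.mul_sum, Finset.mul_sum, ← Finset.sum_add_distrib]
          exact Finset.sum_congr rfl fun A _ => by ring
        · calc
            _ = q x * ∑ A : Fin K → X, (∏ k, q (A k)) *
                (w (#{k | c (A k)}) * ∑ k with c (A k), h (A k)) := by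
              rw [Finset.mul_sum]
              exact Finset.sum_congr rfl fun A _ => by rw [zero_add, zero_add, mul_assoc]
            _ = 0 * M := by rw [i₁, mul_zero, zero_mul]
      rw [Finset.sum_congr rfl fun x _ => key x, ← Finset.sum_mul, ← Finset.sum_filter, h₁,
        zero_mul]
    · have key (x : X) : ∑ A : Fin K → X, q x * (∏ k, q (A k)) *
          (w ((if c x then 1 else 0) + #{k | c (A k)}) *
            ((if c x then h x else 0) + ∑ k with c (A k), h (A k)) ^ 2) =
          (if c x then q x * h x ^ 2 else 0) * M + (if c x then q x else 0) * (s * N) +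
            (if c x then 0 else q x) * (s * R) := by
        split_ifs with hx
        · have : q x * h x ^ 2 * M + q x * (s * N) + 0 * (s * R) =
              q x * h x ^ 2 * M + q x * (s * N) + 2 * q x * h x * 0 := by ring
          rw [this, ← j₂, ← j₁, hM, Finset.mul_sum, Finset.mul_sum, Finset.mul_sum,
            ← Finset.sum_add_distrib, ← Finset.sum_add_distrib]
          exact Finset.sum_congr rfl fun A _ => by ring
        · rw [zero_mul, zero_mul, zero_add, zero_add, ← i₂, Finset.mul_sum]
          exact Finset.sum_congr rfl fun A _ => by simp only [zero_add]; ring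
      have key' (x : X) : ∑ A : Fin K → X, q x * (∏ k, q (A k)) *
          (w ((if c x then 1 else 0) + #{k | c (A k)}) *
            (((if c x then 1 else 0) + #{k | c (A k)} : ℕ) : ℝ)) =
          (if c x then q x else 0) * (M + N) + (if c x then 0 else q x) * R := by
        split_ifs with hx
        · rw [zero_mul, add_zero, hM, hN, ← Finset.sum_add_distrib, Finset.mul_sum]
          exact Finset.sum_congr rfl fun A _ => by push_cast; ring
        · rw [zero_mul, zero_add, hR, Finset.mul_sum]
          exact Finset.sum_congr rfl fun A _ => by simp only [zero_add]; ring
      rw [Finset.sum_congr rfl fun x _ => key x, Finset.sum_congr rfl fun x _ => key' x]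
      simp only [Finset.sum_add_distrib, ← Finset.sum_mul, ← Finset.sum_filter (s := univ) (p := c)]
      rw [h₂]
      ring

/-- Moments of the mean of one sample drawn from `p` and of those samples drawn from `q`
that satisfy `c`. -/
lemma weighted_moments_mean (p q u v : X → ℝ) (c : X → Prop) [DecidablePred c] (r μ s : ℝ)
    (hp : ∑ x, p x = 1) (hp₁ : ∑ x, p x * u x = μ) (hp₂ : ∑ x, p x * (u x - μ) ^ 2 = s)
    (hq : ∑ x with c x, q x = r) (hq₁ : ∑ x with c x, q x * v x = r * μ)
    (hq₂ : ∑ x with c x, q x * (v x - μ) ^ 2 = r * s) (K : ℕ) (w : ℕ → ℝ) :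
    (∑ B, ∑ A : Fin K → X, p B * (∏ k, q (A k)) * (w (1 + #{k | c (A k)}) *
        ((u B + ∑ k with c (A k), v (A k)) / ((1 + #{k | c (A k)} : ℕ) : ℝ) - μ)) = 0) ∧
    (∑ B, ∑ A : Fin K → X, p B * (∏ k, q (A k)) * (w (1 + #{k | c (A k)}) *
        ((u B + ∑ k with c (A k), v (A k)) / ((1 + #{k | c (A k)} : ℕ) : ℝ) - μ) ^ 2) =
      s * ∑ B, ∑ A : Fin K → X, p B * (∏ k, q (A k)) *
        (w (1 + #{k | c (A k)}) / ((1 + #{k | c (A k)} : ℕ) : ℝ))) := by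
  have hq₁' : ∑ x with c x, q x * (v x - μ) = 0 := by
    simp only [mul_sub, Finset.sum_sub_distrib, ← Finset.sum_mul, hq, hq₁, sub_self]
  have hp₁' : ∑ x, p x * (u x - μ) = 0 := by
    simp only [mul_sub, Finset.sum_sub_distrib, ← Finset.sum_mul, hp, hp₁, one_mul, sub_self]
  have hmean (B : X) (A : Fin K → X) :
      (u B + ∑ k with c (A k), v (A k)) / ((1 + #{k | c (A k)} : ℕ) : ℝ) - μ =
        ((u B - μ) + ∑ k with c (A k), (v (A k) - μ)) / ((1 + #{k | c (A k)} : ℕ) : ℝ) := by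
    have : ((1 + #{k | c (A k)} : ℕ) : ℝ) ≠ 0 := by positivity
    rw [Finset.sum_sub_distrib, Finset.sum_const, nsmul_eq_mul]
    field_simp
    push_cast
    ring
  simp only [hmean]
  have H := weighted_moments_sum q (fun x => v x - μ) c s hq₁' (by rw [hq₂, hq, mul_comm]) K
  have a₁ := (H fun m => w (1 + m) / ((1 + m : ℕ) : ℝ)).1
  obtain ⟨b₁, b₂⟩ := H fun m => w (1 + m) / ((1 + m : ℕ) : ℝ) ^ 2
  set M := ∑ A : Fin K → X, (∏ k, q (A k)) *
    (w (1 + #{k | c (A k)}) / ((1 + #{k | c (A k)} : ℕ) : ℝ)) with hM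
  set N := ∑ A : Fin K → X, (∏ k, q (A k)) *
    (w (1 + #{k | c (A k)}) / ((1 + #{k | c (A k)} : ℕ) : ℝ) ^ 2) with hN
  set R := ∑ A : Fin K → X, (∏ k, q (A k)) *
    (w (1 + #{k | c (A k)}) / ((1 + #{k | c (A k)} : ℕ) : ℝ) ^ 2 * #{k | c (A k)}) with hR
  have hMN : M = N + R := by
    rw [hM, hN, hR, ← Finset.sum_add_distrib]
    refine Finset.sum_congr rfl fun A _ => ?_
    have : ((1 + #{k | c (A k)} : ℕ) : ℝ) ≠ 0 := by positivity
    push_cast at this ⊢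
    field_simp
  constructor
  · have key (B : X) : ∑ A : Fin K → X, p B * (∏ k, q (A k)) * (w (1 + #{k | c (A k)}) *
        (((u B - μ) + ∑ k with c (A k), (v (A k) - μ)) / ((1 + #{k | c (A k)} : ℕ) : ℝ))) =
        p B * (u B - μ) * M := by
      have : p B * (u B - μ) * M = p B * (u B - μ) * M + p B * 0 := by ring
      rw [this, ← a₁, hM, Finset.mul_sum, Finset.mul_sum, ← Finset.sum_add_distrib]
      exact Finset.sum_congr rfl fun A _ => by ring
    rw [Finset.sum_congr rfl fun B _ => key B, ← Finset.sum_mul, hp₁', zero_mul]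
  · have key (B : X) : ∑ A : Fin K → X, p B * (∏ k, q (A k)) * (w (1 + #{k | c (A k)}) *
        (((u B - μ) + ∑ k with c (A k), (v (A k) - μ)) / ((1 + #{k | c (A k)} : ℕ) : ℝ)) ^ 2) =
        p B * (u B - μ) ^ 2 * N + p B * (s * R) := by
      have : p B * (u B - μ) ^ 2 * N + p B * (s * R) =
        p B * (u B - μ) ^ 2 * N + p B * (s * R) + 2 * p B * (u B - μ) * 0 := by ring
      rw [this, ← b₂, ← b₁, hN, Finset.mul_sum, Finset.mul_sum, Finset.mul_sum,
        ← Finset.sum_add_distrib, ← Finset.sum_add_distrib]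
      exact Finset.sum_congr rfl fun A _ => by ring
    have key' (B : X) : ∑ A : Fin K → X, p B * (∏ k, q (A k)) *
        (w (1 + #{k | c (A k)}) / ((1 + #{k | c (A k)} : ℕ) : ℝ)) = p B * M := by
      rw [hM, Finset.mul_sum]
      exact Finset.sum_congr rfl fun A _ => by ring
    rw [Finset.sum_congr rfl fun B _ => key B, Finset.sum_congr rfl fun B _ => key' B,
      Finset.sum_add_distrib, ← Finset.sum_mul, ← Finset.sum_mul, ← Finset.sum_mul, hp₂, hp, hMN]
    ring

end WeightedSums

lemma sum_powerset_Ni_wgt (n : ℕ) (hn : 1 ≤ n) (i : Fin n) :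
    ∑ S ∈ (Ni n i).powerset, wgt n S = 1 := by
  have hcard : (Ni n i).card = n - 1 := by simp [Ni]
  unfold wgt
  rw [Finset.sum_powerset_apply_card (fun m => 1 / ((n : ℝ) * (Nat.choose (n - 1) m : ℝ))), hcard]
  have : ∀ m ∈ Finset.range (n - 1 + 1),
      (n - 1).choose m • (1 / ((n : ℝ) * (Nat.choose (n - 1) m : ℝ))) = 1 / n := by
    intro m hm
    have h0 : ((n - 1).choose m : ℝ) ≠ 0 := by
      have := Nat.choose_pos (n := n - 1) (k := m) (by simp at hm; omega)
      positivity
    rw [nsmul_eq_mul]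
    field_simp
  rw [Finset.sum_congr rfl this, Finset.sum_const, Finset.card_range, Nat.sub_add_cancel hn,
    nsmul_eq_mul]
  have : (n : ℝ) ≠ 0 := by positivity
  field_simp

lemma Pplus_insert (n : ℕ) (i : Fin n) {S : Finset (Fin n)} (hS : S ⊆ Ni n i) :
    Pplus n (insert i S) = 1 / harm n * wgt n S := by
  have hi : i ∉ S := fun h => by simpa [Ni] using hS h
  obtain ⟨m, rfl⟩ : ∃ m, n = m + 1 := ⟨n - 1, by have := i.pos; omega⟩
  have h : ((m + 1 : ℕ) : ℝ) * (m.choose S.card : ℝ) =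
      ((m + 1).choose (S.card + 1) : ℝ) * ((S.card + 1 : ℕ) : ℝ) := by
    exact_mod_cast Nat.add_one_mul_choose_eq m S.card
  rw [Pplus, wgt, Finset.card_insert_of_notMem hi, Nat.add_sub_cancel, h, one_div_mul_one_div]
  congr 1
  ring

lemma Pminus_eq (n : ℕ) (i : Fin n) {S : Finset (Fin n)} (hS : S ⊆ Ni n i) :
    Pminus n S = 1 / harm n * wgt n S := by
  have hcard : S.card ≤ n - 1 := by simpa [Ni] using Finset.card_le_card hS
  obtain ⟨m, rfl⟩ : ∃ m, n = m + 1 := ⟨n - 1, by have := i.pos; omega⟩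
  have h : ((m + 1 : ℕ) : ℝ) * (m.choose S.card : ℝ) =
      ((m + 1).choose S.card : ℝ) * (((m + 1 : ℕ) : ℝ) - S.card) := by
    rw [← Nat.cast_sub (by omega), ← Nat.cast_mul, ← Nat.cast_mul, mul_comm (m + 1)]
    exact_mod_cast Nat.choose_mul_succ_eq m S.card
  rw [Pminus, wgt, Nat.add_sub_cancel, h, one_div_mul_one_div]
  congr 1
  ring

lemma sum_mem_eq_sum_insert (n : ℕ) (i : Fin n) (F : Finset (Fin n) → ℝ) :
    ∑ S with i ∈ S, F S = ∑ S ∈ (Ni n i).powerset, F (insert i S) := by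
  symm
  refine Finset.sum_bij' (fun S _ => insert i S) (fun S _ => S.erase i) ?_ ?_ ?_ ?_ ?_
  · simp
  · intro S _
    exact Finset.mem_powerset.2 (Finset.erase_subset_erase i (Finset.subset_univ S))
  · intro S hS
    exact Finset.erase_insert fun h => by simpa [Ni] using Finset.mem_powerset.1 hS h
  · intro S hS
    exact Finset.insert_erase (by simpa using hS)
  · simp

lemma sum_notMem_eq_sum_powerset (n : ℕ) (i : Fin n) (F : Finset (Fin n) → ℝ) :
    ∑ S with i ∉ S, F S = ∑ S ∈ (Ni n i).powerset, F S := by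
  refine Finset.sum_congr ?_ fun _ _ => rfl
  ext S
  simp [Ni, Finset.subset_erase]

lemma sum_warmup_mul (n : ℕ) (i : Fin n) (F : Finset (Fin n) → ℝ) :
    ∑ S, (if S ⊆ Ni n i then wgt n S else 0) * F S = ∑ S ∈ (Ni n i).powerset, wgt n S * F S := by
  simp only [ite_mul, zero_mul, ← Finset.sum_filter]
  refine Finset.sum_congr ?_ fun _ _ => rfl
  ext S
  simp

/-- Sum of `F` over the warm-up and main samples of the positive part, weighted by their law. -/
noncomputable def expPlus (n K : ℕ) (i : Fin n)
    (F : Finset (Fin n) → (Fin K → Finset (Fin n)) → ℝ) : ℝ :=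
  ∑ B, ∑ A, (if B ⊆ Ni n i then wgt n B else 0) * (∏ k, Pplus n (A k)) * F B A

/-- Sum of `F` over the warm-up and main samples of the negative part, weighted by their law. -/
noncomputable def expMinus (n K : ℕ) (i : Fin n)
    (F : Finset (Fin n) → (Fin K → Finset (Fin n)) → ℝ) : ℝ :=
  ∑ B, ∑ A, (if B ⊆ Ni n i then wgt n B else 0) * (∏ k, Pminus n (A k)) * F B A

lemma sum_jointP_mul (n K : ℕ) (i : Fin n)
    (F G : Finset (Fin n) → (Fin K → Finset (Fin n)) → ℝ) :
    ∑ ω : Omega n K, jointP n K i ω * (F ω.1 ω.2.2.1 * G ω.2.1 ω.2.2.2) =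
      expPlus n K i F * expMinus n K i G := by
  simp only [expPlus, expMinus, Fintype.sum_prod_type, jointP]
  rw [Finset.sum_mul_sum]
  refine Finset.sum_congr rfl fun B _ => Finset.sum_congr rfl fun C _ => ?_
  rw [Finset.sum_mul_sum]
  exact Finset.sum_congr rfl fun A _ => Finset.sum_congr rfl fun D _ => by ring

lemma expPlus_moments (n K : ℕ) (hn : 1 ≤ n) (ν : Finset (Fin n) → ℝ) (i : Fin n) (a : ℕ) :
    expPlus n K i (fun B A => (if 1 + #{k | i ∈ A k} = a then 1 else 0) *
      ((ν (insert i B) + ∑ k with i ∈ A k, ν (A k)) / ((1 + #{k | i ∈ A k} : ℕ) : ℝ) -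
        phiPlus n ν i)) = 0 ∧
    expPlus n K i (fun B A => (if 1 + #{k | i ∈ A k} = a then 1 else 0) *
      ((ν (insert i B) + ∑ k with i ∈ A k, ν (A k)) / ((1 + #{k | i ∈ A k} : ℕ) : ℝ) -
        phiPlus n ν i) ^ 2) =
      sigPlusSq n ν i / a *
        expPlus n K i (fun _ A => if 1 + #{k | i ∈ A k} = a then 1 else 0) := by
  have hrw (F : Finset (Fin n) → ℝ) : ∑ S with i ∈ S, Pplus n S * F S =
      1 / harm n * ∑ S ∈ (Ni n i).powerset, wgt n S * F (insert i S) := by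
    rw [sum_mem_eq_sum_insert, Finset.mul_sum]
    refine Finset.sum_congr rfl fun S hS => ?_
    rw [Pplus_insert n i (Finset.mem_powerset.1 hS), mul_assoc]
  have H := weighted_moments_mean (fun S => if S ⊆ Ni n i then wgt n S else 0) (Pplus n)
    (fun S => ν (insert i S)) ν (fun S => i ∈ S) (1 / harm n) (phiPlus n ν i) (sigPlusSq n ν i)
    (by simpa [sum_powerset_Ni_wgt n hn] using sum_warmup_mul n i fun _ => 1)
    (sum_warmup_mul n i _) (sum_warmup_mul n i _)
    (by simpa [sum_powerset_Ni_wgt n hn] using hrw fun _ => 1)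
    (hrw _) (hrw fun S => (ν S - phiPlus n ν i) ^ 2) K (fun m => if m = a then 1 else 0)
  refine ⟨H.1, H.2.trans ?_⟩
  rw [expPlus, div_mul_eq_mul_div, mul_div_assoc]
  congr 1
  rw [Finset.sum_div]
  refine Finset.sum_congr rfl fun B _ => ?_
  rw [Finset.sum_div]
  refine Finset.sum_congr rfl fun A _ => ?_
  rw [mul_div_assoc]
  congr 1
  split_ifs with h
  · rw [h]
  · simp

lemma expMinus_moments (n K : ℕ) (hn : 1 ≤ n) (ν : Finset (Fin n) → ℝ) (i : Fin n) (b : ℕ) :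
    expMinus n K i (fun B A => (if 1 + #{k | i ∉ A k} = b then 1 else 0) *
      ((ν B + ∑ k with i ∉ A k, ν (A k)) / ((1 + #{k | i ∉ A k} : ℕ) : ℝ) -
        phiMinus n ν i)) = 0 ∧
    expMinus n K i (fun B A => (if 1 + #{k | i ∉ A k} = b then 1 else 0) *
      ((ν B + ∑ k with i ∉ A k, ν (A k)) / ((1 + #{k | i ∉ A k} : ℕ) : ℝ) -
        phiMinus n ν i) ^ 2) =
      sigMinusSq n ν i / b *
        expMinus n K i (fun _ A => if 1 + #{k | i ∉ A k} = b then 1 else 0) := by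
  have hrw (F : Finset (Fin n) → ℝ) : ∑ S with i ∉ S, Pminus n S * F S =
      1 / harm n * ∑ S ∈ (Ni n i).powerset, wgt n S * F S := by
    rw [sum_notMem_eq_sum_powerset, Finset.mul_sum]
    refine Finset.sum_congr rfl fun S hS => ?_
    rw [Pminus_eq n i (Finset.mem_powerset.1 hS), mul_assoc]
  have H := weighted_moments_mean (fun S => if S ⊆ Ni n i then wgt n S else 0) (Pminus n)
    ν ν (fun S => i ∉ S) (1 / harm n) (phiMinus n ν i) (sigMinusSq n ν i)
    (by simpa [sum_powerset_Ni_wgt n hn] using sum_warmup_mul n i fun _ => 1)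
    (sum_warmup_mul n i _) (sum_warmup_mul n i _)
    (by simpa [sum_powerset_Ni_wgt n hn] using hrw fun _ => 1)
    (hrw _) (hrw fun S => (ν S - phiMinus n ν i) ^ 2) K (fun m => if m = b then 1 else 0)
  refine ⟨H.1, H.2.trans ?_⟩
  rw [expMinus, div_mul_eq_mul_div, mul_div_assoc]
  congr 1
  rw [Finset.sum_div]
  refine Finset.sum_congr rfl fun B _ => ?_
  rw [Finset.sum_div]
  refine Finset.sum_congr rfl fun A _ => ?_
  rw [mul_div_assoc]
  congr 1
  split_ifs with h
  · rw [h]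
  · simp

/-- Conditionally on the sample counts `m_i⁺` and `m_i⁻`, the variance of `φ̂_i` is
exactly `σ_i⁺²/m_i⁺ + σ_i⁻²/m_i⁻`. -/
theorem stmt9 (n K : ℕ) (hn : 1 ≤ n) (hK : 1 ≤ K) (ν : Finset (Fin n) → ℝ)
    (hν : ν ∅ = 0) (i : Fin n) (a b : ℕ)
    (hpos : 0 < probEvent n K i (fun ω => mplus n K i ω = a ∧ mminus n K i ω = b)) :
    condVar n K i (fun ω => mplus n K i ω = a ∧ mminus n K i ω = b) (phiHat n K ν i)
      = sigPlusSq n ν i / (a : ℝ) + sigMinusSq n ν i / (b : ℝ) := by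
  obtain ⟨p₁, p₂⟩ := expPlus_moments n K hn ν i a
  obtain ⟨m₁, m₂⟩ := expMinus_moments n K hn ν i b
  set U : Finset (Fin n) → (Fin K → Finset (Fin n)) → ℝ :=
    fun _ A => if 1 + #{k | i ∈ A k} = a then 1 else 0 with hU
  set V : Finset (Fin n) → (Fin K → Finset (Fin n)) → ℝ :=
    fun _ A => if 1 + #{k | i ∉ A k} = b then 1 else 0 with hV
  set Y : Finset (Fin n) → (Fin K → Finset (Fin n)) → ℝ := fun B A =>
    (ν (insert i B) + ∑ k with i ∈ A k, ν (A k)) / ((1 + #{k | i ∈ A k} : ℕ) : ℝ) -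
      phiPlus n ν i with hY
  set Z : Finset (Fin n) → (Fin K → Finset (Fin n)) → ℝ := fun B A =>
    (ν B + ∑ k with i ∉ A k, ν (A k)) / ((1 + #{k | i ∉ A k} : ℕ) : ℝ) -
      phiMinus n ν i with hZ
  change expPlus n K i (fun B A => U B A * Y B A) = 0 at p₁
  change expMinus n K i (fun B A => V B A * Z B A) = 0 at m₁
  change expPlus n K i (fun B A => U B A * Y B A ^ 2) = _ at p₂
  change expMinus n K i (fun B A => V B A * Z B A ^ 2) = _ at m₂
  generalize hE : (fun ω : Omega n K => mplus n K i ω = a ∧ mminus n K i ω = b) = E at hpos ⊢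
  have hEsum (f : Omega n K → ℝ) :
      (∑ ω : Omega n K, if E ω then jointP n K i ω * f ω else 0) =
      ∑ ω : Omega n K, jointP n K i ω * (U ω.1 ω.2.2.1 * V ω.2.1 ω.2.2.2 * f ω) := by
    refine Finset.sum_congr rfl fun ω _ => ?_
    have hω : E ω ↔ mplus n K i ω = a ∧ mminus n K i ω = b := by rw [← hE]
    by_cases h₁ : mplus n K i ω = a <;> by_cases h₂ : mminus n K i ω = b <;>
      simp_all [mplus, mminus]
  have hφ (ω : Omega n K) : phiHat n K ν i ω =
      (phiPlus n ν i - phiMinus n ν i) + Y ω.1 ω.2.2.1 - Z ω.2.1 ω.2.2.2 := by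
    simp only [phiHat, phiHatPlus, phiHatMinus, mplus, mminus, hY, hZ]
    ring
  have hprob : probEvent n K i E = expPlus n K i U * expMinus n K i V := by
    rw [← sum_jointP_mul]
    simpa [probEvent] using hEsum fun _ => 1
  rw [hprob] at hpos
  have hmean : condExpVal n K i E (phiHat n K ν i) = phiPlus n ν i - phiMinus n ν i := by
    rw [condExpVal, hprob, div_eq_iff hpos.ne', hEsum]
    have h₁ := sum_jointP_mul n K i (fun B A => U B A * Y B A) V
    have h₂ := sum_jointP_mul n K i U (fun B A => V B A * Z B A)
    rw [p₁, zero_mul] at h₁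
    rw [m₁, mul_zero] at h₂
    rw [← add_zero (_ * (expPlus n K i U * expMinus n K i V)), ← h₁,
      ← sub_zero (_ + ∑ ω : Omega n K, _), ← h₂, ← sum_jointP_mul, Finset.mul_sum,
      ← Finset.sum_add_distrib, ← Finset.sum_sub_distrib]
    refine Finset.sum_congr rfl fun ω _ => ?_
    rw [hφ]
    ring
  rw [condVar, hmean, condExpVal, hprob, div_eq_iff hpos.ne', hEsum]
  have h₁ := sum_jointP_mul n K i (fun B A => U B A * Y B A ^ 2) V
  have h₂ := sum_jointP_mul n K i U (fun B A => V B A * Z B A ^ 2)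
  have h₃ := sum_jointP_mul n K i (fun B A => U B A * Y B A) (fun B A => V B A * Z B A)
  rw [p₂] at h₁
  rw [m₂] at h₂
  rw [p₁, zero_mul] at h₃
  calc
    _ = ∑ ω : Omega n K, jointP n K i ω *
          (U ω.1 ω.2.2.1 * Y ω.1 ω.2.2.1 ^ 2 * V ω.2.1 ω.2.2.2) +
        ∑ ω : Omega n K, jointP n K i ω *
          (U ω.1 ω.2.2.1 * (V ω.2.1 ω.2.2.2 * Z ω.2.1 ω.2.2.2 ^ 2)) -
        2 * ∑ ω : Omega n K, jointP n K i ω *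
          (U ω.1 ω.2.2.1 * Y ω.1 ω.2.2.1 * (V ω.2.1 ω.2.2.2 * Z ω.2.1 ω.2.2.2)) := by
      rw [Finset.mul_sum, ← Finset.sum_add_distrib, ← Finset.sum_sub_distrib]
      refine Finset.sum_congr rfl fun ω _ => ?_
      rw [hφ]
      ring
    _ = _ := by
      rw [h₁, h₂, h₃]
      ring
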